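/- arXiv:1710.10217 — 4 statements merged into one kernel-verified Lean document; each statement's English description precedes it below -/
import Mathlib

section
/- In the finite static game setting, suppose u_b(ω,α) ≥ v_b(ω,α) for every b ∈ B, ω ∈ W and α ∈ A, and suppose the strategy is a coarse correlated equilibrium with respect to (v_b), i.e., v̄_b ≥ ∑_{ω_b∈W_b} Pr(ω_b) θ_b(ω_b) for every b ∈ B. Set ε = max_{b∈B} ∑_{ω_b∈W_b} Pr(ω_b)(μ_b(ω_b) − θ_b(ω_b)). Then ε ≥ 0 and the strategy is an ε-coarse correlated equilibrium with respect to (u_b) with certificates (μ_b): for every b, ω_b ∈ W_b and χ_b ∈ A_b, Pr(ω_b) μ_b(ω_b) ≥ ∑_{ω∈W : b-th comp. ω_b} ∑_{α∈A} Pr(ω) Pr(α|ω) u_b(ω, (χ_b, α_{−b})), and for every b, ū_b ≥ ∑_{ω_b∈W_b} Pr(ω_b) μ_b(ω_b) − ε. -/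
open Finset

/-- Marginal probability `Pr(ω_b)` of player `b`'s local state `ωb` under the
global state distribution `PrW`. -/
noncomputable def margin {B : Type*} [Fintype B] [DecidableEq B]
    {Wb : B → Type*} [∀ b, Fintype (Wb b)] [∀ b, DecidableEq (Wb b)]
    (PrW : (∀ b, Wb b) → ℝ) (b : B) (ωb : Wb b) : ℝ :=
  ∑ ω ∈ univ.filter (fun ω : ∀ b, Wb b => ω b = ωb), PrW ω

/-- Maximum deviation utility
`max_{χ_b ∈ A_b} (1/Pr(ω_b)) ∑_{ω : ω_b fixed} ∑_α Pr(ω) Pr(α|ω) f(ω, (χ_b, α_{−b}))`. -/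
noncomputable def devMax {B : Type*} [Fintype B] [DecidableEq B]
    {Wb : B → Type*} [∀ b, Fintype (Wb b)] [∀ b, DecidableEq (Wb b)]
    {Ab : B → Type*} [∀ b, Fintype (Ab b)] [∀ b, Nonempty (Ab b)]
    (PrW : (∀ b, Wb b) → ℝ) (PrA : (∀ b, Wb b) → (∀ b, Ab b) → ℝ)
    (f : (∀ b, Wb b) → (∀ b, Ab b) → ℝ) (b : B) (ωb : Wb b) : ℝ :=
  (univ : Finset (Ab b)).sup' univ_nonempty (fun χ : Ab b =>
    (margin PrW b ωb)⁻¹ *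
      ∑ ω ∈ univ.filter (fun ω : ∀ b, Wb b => ω b = ωb), ∑ α : ∀ b, Ab b,
        PrW ω * PrA ω α * f ω (Function.update α b χ))

/-- Expected utility `∑_ω ∑_α Pr(ω) Pr(α|ω) f(ω,α)` of a utility function `f`
under the state distribution and the strategy. -/
noncomputable def expUtil {B : Type*} [Fintype B] [DecidableEq B]
    {Wb : B → Type*} [∀ b, Fintype (Wb b)] [∀ b, DecidableEq (Wb b)]
    {Ab : B → Type*} [∀ b, Fintype (Ab b)]
    (PrW : (∀ b, Wb b) → ℝ) (PrA : (∀ b, Wb b) → (∀ b, Ab b) → ℝ)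
    (f : (∀ b, Wb b) → (∀ b, Ab b) → ℝ) : ℝ :=
  ∑ ω : ∀ b, Wb b, ∑ α : ∀ b, Ab b, PrW ω * PrA ω α * f ω α

/-- Proposition 2 of the paper: if `u_b ≥ v_b` pointwise and the strategy is a
coarse correlated equilibrium with respect to the auxiliary utilities `(v_b)`, then
with `ε = max_b ∑_{ω_b} Pr(ω_b)(μ_b(ω_b) − θ_b(ω_b)) ≥ 0` the strategy is an
`ε`-coarse correlated equilibrium with respect to the true utilities `(u_b)`,
with certificates `μ_b = devMax` for `u_b`. -/
theorem stmt3 {B : Type*} [Fintype B] [Nonempty B] [DecidableEq B]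
    {Wb : B → Type*} [∀ b, Fintype (Wb b)] [∀ b, Nonempty (Wb b)]
    [∀ b, DecidableEq (Wb b)]
    {Ab : B → Type*} [∀ b, Fintype (Ab b)] [∀ b, Nonempty (Ab b)]
    (PrW : (∀ b, Wb b) → ℝ)
    (hPrW : ∀ ω, 0 ≤ PrW ω) (hPrWsum : ∑ ω : ∀ b, Wb b, PrW ω = 1)
    (hmargin : ∀ (b : B) (ωb : Wb b), 0 < margin PrW b ωb)
    (PrA : (∀ b, Wb b) → (∀ b, Ab b) → ℝ)
    (hPrA : ∀ ω α, 0 ≤ PrA ω α) (hPrAsum : ∀ ω, ∑ α : ∀ b, Ab b, PrA ω α = 1)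
    (u v : ∀ _ : B, (∀ b, Wb b) → (∀ b, Ab b) → ℝ)
    (huv : ∀ (b : B) (ω : ∀ b, Wb b) (α : ∀ b, Ab b), u b ω α ≥ v b ω α)
    (hCCE : ∀ b : B, expUtil PrW PrA (v b) ≥
      ∑ ωb : Wb b, margin PrW b ωb * devMax PrW PrA (v b) b ωb)
    (ε : ℝ)
    (hε : ε = (univ : Finset B).sup' univ_nonempty (fun b =>
      ∑ ωb : Wb b, margin PrW b ωb *
        (devMax PrW PrA (u b) b ωb - devMax PrW PrA (v b) b ωb))) :
    0 ≤ ε ∧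
    (∀ (b : B) (ωb : Wb b) (χb : Ab b),
      margin PrW b ωb * devMax PrW PrA (u b) b ωb ≥
        ∑ ω ∈ univ.filter (fun ω : ∀ b, Wb b => ω b = ωb), ∑ α : ∀ b, Ab b,
          PrW ω * PrA ω α * u b ω (Function.update α b χb)) ∧
    (∀ b : B, expUtil PrW PrA (u b) ≥
      (∑ ωb : Wb b, margin PrW b ωb * devMax PrW PrA (u b) b ωb) - ε) := by
  have hmono : ∀ (b : B) (ωb : Wb b),
      devMax PrW PrA (v b) b ωb ≤ devMax PrW PrA (u b) b ωb := by
    intro b ωb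
    unfold devMax
    refine Finset.sup'_mono_fun ?_
    intro χ _
    refine mul_le_mul_of_nonneg_left ?_ (inv_nonneg.mpr (hmargin b ωb).le)
    refine Finset.sum_le_sum fun ω _ => Finset.sum_le_sum fun α _ => ?_
    exact mul_le_mul_of_nonneg_left (huv b ω _) (mul_nonneg (hPrW ω) (hPrA ω α))
  have hle : ∀ b : B, ∑ ωb : Wb b, margin PrW b ωb *
        (devMax PrW PrA (u b) b ωb - devMax PrW PrA (v b) b ωb) ≤ ε := by
    intro b
    rw [hε]
    exact Finset.le_sup' (fun b => ∑ ωb : Wb b, margin PrW b ωb *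
        (devMax PrW PrA (u b) b ωb - devMax PrW PrA (v b) b ωb)) (Finset.mem_univ b)
  refine ⟨?_, ?_, ?_⟩
  · obtain ⟨b⟩ := ‹Nonempty B›
    refine le_trans (Finset.sum_nonneg fun ωb _ => ?_) (hle b)
    exact mul_nonneg (hmargin b ωb).le (sub_nonneg.mpr (hmono b ωb))
  · intro b ωb χb
    have h : (margin PrW b ωb)⁻¹ *
        ∑ ω ∈ univ.filter (fun ω : ∀ b, Wb b => ω b = ωb), ∑ α : ∀ b, Ab b,
          PrW ω * PrA ω α * u b ω (Function.update α b χb)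
        ≤ devMax PrW PrA (u b) b ωb :=
      Finset.le_sup' (fun χ : Ab b => (margin PrW b ωb)⁻¹ *
        ∑ ω ∈ univ.filter (fun ω : ∀ b, Wb b => ω b = ωb), ∑ α : ∀ b, Ab b,
          PrW ω * PrA ω α * u b ω (Function.update α b χ)) (Finset.mem_univ χb)
    exact (inv_mul_le_iff₀ (hmargin b ωb)).mp h
  · intro b
    have h1 := hle b
    simp only [mul_sub, Finset.sum_sub_distrib] at h1
    have h2 : expUtil PrW PrA (v b) ≤ expUtil PrW PrA (u b) := by
      unfold expUtil
      refine Finset.sum_le_sum fun ω _ => Finset.sum_le_sum fun α _ => ?_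
      exact mul_le_mul_of_nonneg_left (huv b ω α) (mul_nonneg (hPrW ω) (hPrA ω α))
    have h3 := hCCE b
    linarith
end

section
/- In the power-allocation setting, suppose P* = (P*_i)_{i∈X} satisfies P*_i ≥ 0 for all i, ∑_{i∈X} P*_i = B, and there exists γ > 0 such that for every i ∈ X: if P*_i > 0 then ∑_{k∈K_i} p_{i,k} · w_i h_i/(σ² + I_{i,k} + P*_i h_i) = γ, and if P*_i = 0 then ∑_{k∈K_i} p_{i,k} · w_i h_i/(σ² + I_{i,k}) ≤ γ. Then P* is a global maximizer: f(P) ≤ f(P*) for every P = (P_i)_{i∈X} with P_i ≥ 0 for all i and ∑_{i∈X} P_i ≤ B. -/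
open Finset

/-- Power-allocation objective
`f(P) = ∑_i w_i ∑_k p_{i,k} ln(1 + P_i h_i/(σ² + I_{i,k}))`. -/
noncomputable def powObj {X : Type*} [Fintype X] {K : X → Type*} [∀ i, Fintype (K i)]
    (σ2 : ℝ) (w h : X → ℝ) (p : ∀ i, K i → ℝ) (I : ∀ i, K i → ℝ)
    (P : X → ℝ) : ℝ :=
  ∑ i : X, w i * ∑ k : K i, p i k * Real.log (1 + P i * h i / (σ2 + I i k))

/-- Sufficiency direction of Lemma 1 (KKT water-filling): a feasible `P*` using the
full budget that satisfies the water-filling conditions for some multiplier `γ > 0`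
is a global maximizer of the objective over the budget-constrained set. -/
theorem stmt5 {X : Type*} [Fintype X] [Nonempty X]
    {K : X → Type*} [∀ i, Fintype (K i)] [∀ i, Nonempty (K i)]
    (σ2 Bud : ℝ) (hσ2 : 0 < σ2) (hBud : 0 < Bud)
    (w h : X → ℝ) (hw : ∀ i, 0 < w i) (hh : ∀ i, 0 < h i)
    (p : ∀ i, K i → ℝ) (hp : ∀ i k, 0 ≤ p i k) (hpsum : ∀ i, ∑ k, p i k = 1)
    (I : ∀ i, K i → ℝ) (hI : ∀ i k, 0 ≤ I i k)
    (Pstar : X → ℝ) (hPstar : ∀ i, 0 ≤ Pstar i) (hPsum : ∑ i, Pstar i = Bud)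
    (γ : ℝ) (hγ : 0 < γ)
    (hpos : ∀ i, 0 < Pstar i →
      ∑ k, p i k * (w i * h i / (σ2 + I i k + Pstar i * h i)) = γ)
    (hzero : ∀ i, Pstar i = 0 →
      ∑ k, p i k * (w i * h i / (σ2 + I i k)) ≤ γ) :
    ∀ P : X → ℝ, (∀ i, 0 ≤ P i) → ∑ i, P i ≤ Bud →
      powObj σ2 w h p I P ≤ powObj σ2 w h p I Pstar := by
  intro P hP hPB
  have key : ∀ i, w i * ∑ k : K i, p i k * Real.log (1 + P i * h i / (σ2 + I i k)) ≤
      w i * ∑ k : K i, p i k * Real.log (1 + Pstar i * h i / (σ2 + I i k))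
        + γ * (P i - Pstar i) := by
    intro i
    have h1 : w i * ∑ k : K i, p i k * Real.log (1 + P i * h i / (σ2 + I i k)) ≤
        w i * ∑ k : K i, p i k * Real.log (1 + Pstar i * h i / (σ2 + I i k))
        + (∑ k, p i k * (w i * h i / (σ2 + I i k + Pstar i * h i))) * (P i - Pstar i) := by
      rw [Finset.mul_sum, Finset.mul_sum, Finset.sum_mul, ← Finset.sum_add_distrib]
      apply Finset.sum_le_sum
      intro k _
      have ha : 0 < σ2 + I i k := by linarith [hI i k]
      have hx : 0 ≤ P i * h i := mul_nonneg (hP i) (hh i).le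
      have hy : 0 ≤ Pstar i * h i := mul_nonneg (hPstar i) (hh i).le
      have hb : 0 < σ2 + I i k + Pstar i * h i := by linarith
      have hc : 0 < σ2 + I i k + P i * h i := by linarith
      have e1 : 1 + P i * h i / (σ2 + I i k) = (σ2 + I i k + P i * h i) / (σ2 + I i k) := by
        field_simp
      have e2 : 1 + Pstar i * h i / (σ2 + I i k)
          = (σ2 + I i k + Pstar i * h i) / (σ2 + I i k) := by
        field_simp
      have hl := Real.log_le_sub_one_of_pos (div_pos hc hb)
      rw [Real.log_div hc.ne' hb.ne'] at hl
      have e3 : (σ2 + I i k + P i * h i) / (σ2 + I i k + Pstar i * h i) - 1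
          = h i / (σ2 + I i k + Pstar i * h i) * (P i - Pstar i) := by
        rw [div_sub_one hb.ne', div_mul_eq_mul_div]
        congr 1
        ring
      rw [e3] at hl
      rw [e1, e2, Real.log_div hc.ne' ha.ne', Real.log_div hb.ne' ha.ne']
      have hm := mul_le_mul_of_nonneg_left hl (mul_nonneg (hw i).le (hp i k))
      have e4 : p i k * (w i * h i / (σ2 + I i k + Pstar i * h i)) * (P i - Pstar i)
          = w i * p i k * (h i / (σ2 + I i k + Pstar i * h i) * (P i - Pstar i)) := by
        ring
      rw [e4]
      linarith
    refine h1.trans ?_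
    rcases (hPstar i).lt_or_eq with h0 | h0
    · rw [hpos i h0]
    · have hz := hzero i h0.symm
      have := mul_le_mul_of_nonneg_right hz (hP i)
      rw [← h0]
      simpa using this
  unfold powObj
  have hs := Finset.sum_le_sum (fun i (_ : i ∈ Finset.univ) => key i)
  rw [Finset.sum_add_distrib, ← Finset.mul_sum, Finset.sum_sub_distrib, hPsum] at hs
  have : γ * (∑ i, P i - Bud) ≤ 0 := mul_nonpos_of_nonneg_of_nonpos hγ.le (by linarith)
  linarith
end

section
/- In the power-allocation setting, suppose P* = (P*_i)_{i∈X} with P*_i ≥ 0 and ∑_{i∈X} P*_i = B satisfies f(P*) ≥ f(P) for every P with P_i ≥ 0 and ∑_{i∈X} P_i = B. Then there exists γ ∈ ℝ such that for every i ∈ X: if P*_i > 0 then ∑_{k∈K_i} p_{i,k} · w_i h_i/(σ² + I_{i,k} + P*_i h_i) = γ, and if P*_i = 0 then ∑_{k∈K_i} p_{i,k} · w_i h_i/(σ² + I_{i,k}) ≤ γ. -/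
open Finset

/-- Necessity direction of Lemma 1 (Appendix C): any maximizer `P*` of the
objective over the equality-constrained feasible set satisfies the KKT
water-filling conditions for some multiplier `γ`. -/
theorem stmt6 {X : Type*} [Fintype X] [Nonempty X]
    {K : X → Type*} [∀ i, Fintype (K i)] [∀ i, Nonempty (K i)]
    (σ2 Bud : ℝ) (hσ2 : 0 < σ2) (hBud : 0 < Bud)
    (w h : X → ℝ) (hw : ∀ i, 0 < w i) (hh : ∀ i, 0 < h i)
    (p : ∀ i, K i → ℝ) (hp : ∀ i k, 0 ≤ p i k) (hpsum : ∀ i, ∑ k, p i k = 1)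
    (I : ∀ i, K i → ℝ) (hI : ∀ i k, 0 ≤ I i k)
    (Pstar : X → ℝ) (hPstar : ∀ i, 0 ≤ Pstar i) (hPsum : ∑ i, Pstar i = Bud)
    (hmax : ∀ P : X → ℝ, (∀ i, 0 ≤ P i) → ∑ i, P i = Bud →
      powObj σ2 w h p I P ≤ powObj σ2 w h p I Pstar) :
    ∃ γ : ℝ, ∀ i : X,
      (0 < Pstar i →
        ∑ k, p i k * (w i * h i / (σ2 + I i k + Pstar i * h i)) = γ) ∧
      (Pstar i = 0 →
        ∑ k, p i k * (w i * h i / (σ2 + I i k)) ≤ γ) := by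
  classical
  set G : X → ℝ := fun i => ∑ k, p i k * (w i * h i / (σ2 + I i k + Pstar i * h i)) with hG
  have hder : ∀ d : X → ℝ, HasDerivAt
      (fun t : ℝ => powObj σ2 w h p I (fun i => Pstar i + t * d i)) (∑ i, G i * d i) 0 := by
    intro d
    unfold powObj
    apply HasDerivAt.fun_sum
    intro i _
    have h1 : HasDerivAt (fun t : ℝ => ∑ k : K i,
        p i k * Real.log (1 + (Pstar i + t * d i) * h i / (σ2 + I i k)))
        (∑ k : K i, p i k * (d i * h i / (σ2 + I i k + Pstar i * h i))) 0 := by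
      apply HasDerivAt.fun_sum
      intro k _
      apply HasDerivAt.const_mul
      have hs : 0 < σ2 + I i k := by linarith [hI i k]
      have hPh : 0 ≤ Pstar i * h i := mul_nonneg (hPstar i) (hh i).le
      have hin : HasDerivAt (fun t : ℝ => 1 + (Pstar i + t * d i) * h i / (σ2 + I i k))
          (d i * h i / (σ2 + I i k)) 0 := by
        have := ((((hasDerivAt_id (0:ℝ)).mul_const (d i)).const_add (Pstar i)).mul_const
          (h i)).div_const (σ2 + I i k) |>.const_add 1
        simpa using this
      have hpos : 0 < 1 + (Pstar i + 0 * d i) * h i / (σ2 + I i k) := by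
        have : 0 ≤ Pstar i * h i / (σ2 + I i k) := div_nonneg hPh hs.le
        simp only [zero_mul, add_zero]
        linarith
      have := hin.log hpos.ne'
      refine this.congr_deriv ?_
      have h2 : σ2 + I i k + Pstar i * h i ≠ 0 := by positivity
      have h3 : 1 + (Pstar i + 0 * d i) * h i / (σ2 + I i k)
          = (σ2 + I i k + Pstar i * h i) / (σ2 + I i k) := by
        field_simp
        ring
      rw [h3]
      field_simp
    refine (h1.const_mul (w i)).congr_deriv ?_
    rw [hG, Finset.sum_mul, Finset.mul_sum]
    refine Finset.sum_congr rfl fun k _ => ?_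
    ring
  have key : ∀ i j, 0 < Pstar j → G i ≤ G j := by
    intro i j hj
    have hd := hder (fun a => (if a = i then 1 else 0) - (if a = j then 1 else 0))
    have hs : ∑ a, G a * ((if a = i then (1:ℝ) else 0) - (if a = j then 1 else 0))
        = G i - G j := by
      simp [mul_sub, Finset.sum_sub_distrib]
    rw [hs] at hd
    have ht := (hasDerivWithinAt_iff_tendsto_slope' (s := Set.Ioi (0:ℝ)) (by simp)).1
      hd.hasDerivWithinAt
    have : G i - G j ≤ 0 := by
      refine le_of_tendsto ht ?_
      filter_upwards [Ioo_mem_nhdsGT hj] with t ht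
      rw [slope_def_field]
      apply div_nonpos_of_nonpos_of_nonneg
      · have := hmax (fun a => Pstar a + t *
          ((if a = i then (1:ℝ) else 0) - (if a = j then 1 else 0))) ?_ ?_
        · simpa using this
        · intro a
          have h0 := hPstar a
          have h1 := ht.1
          have h2 := ht.2
          by_cases haj : a = j
          · subst haj
            simp only [if_true]
            split_ifs <;> linarith
          · simp only [haj, if_false]
            split_ifs <;> linarith
        · simp [Finset.sum_add_distrib, ← Finset.mul_sum, Finset.sum_sub_distrib, hPsum]
      · linarith [ht.1]
    linarith
  obtain ⟨j, hj⟩ : ∃ j, 0 < Pstar j := by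
    by_contra! hc
    have : ∑ i, Pstar i ≤ 0 := Finset.sum_nonpos fun i _ => hc i
    linarith
  refine ⟨G j, fun i => ⟨fun hi => le_antisymm (key i j hj) (key j i hi), fun hi => ?_⟩⟩
  have := key i j hj
  have h4 : G i = ∑ k, p i k * (w i * h i / (σ2 + I i k)) := by simp [hG, hi]
  rwa [h4] at this
end

section
/- Let F ∈ ℝ, c > 0 and M > 0, and define g(γ) = Fγ − c·ln(1+γ) for γ ∈ [0,M]. Define γ* as follows: γ* = M if F ≤ c/(M+1); γ* = c/F − 1 if c/(M+1) < F ≤ c; and γ* = 0 if F > c. Then γ* ∈ [0,M] and g(γ*) ≤ g(γ) for every γ ∈ [0,M]. -/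
theorem stmt11_aux (F c s g : ℝ) (hc : 0 < c) (hs : 0 ≤ s) (hg : 0 ≤ g)
    (h : 0 ≤ (F - c / (1 + s)) * (g - s)) :
    F * s - c * Real.log (1 + s) ≤ F * g - c * Real.log (1 + g) := by
  have hs1 : 0 < 1 + s := by linarith
  have hg1 : 0 < 1 + g := by linarith
  have h1 := Real.log_le_sub_one_of_pos (div_pos hg1 hs1)
  rw [Real.log_div hg1.ne' hs1.ne'] at h1
  have h2 : c * ((1 + g) / (1 + s) - 1) = c / (1 + s) * (g - s) := by
    field_simp
    ring
  have h3 := mul_le_mul_of_nonneg_left h1 hc.le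
  rw [h2] at h3
  nlinarith

/-- Closed-form solution of the first decomposed Lyapunov sub-problem P1:
the point `γ* = M` if `F ≤ c/(M+1)`, `γ* = c/F − 1` if `c/(M+1) < F ≤ c`, and
`γ* = 0` otherwise, minimizes `g(γ) = Fγ − c·ln(1+γ)` over `γ ∈ [0, M]`. -/
theorem stmt11 (F c M : ℝ) (hc : 0 < c) (hM : 0 < M)
    (γs : ℝ)
    (hγs : γs = if F ≤ c / (M + 1) then M else if F ≤ c then c / F - 1 else 0) :
    γs ∈ Set.Icc (0 : ℝ) M ∧
      ∀ γ ∈ Set.Icc (0 : ℝ) M,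
        F * γs - c * Real.log (1 + γs) ≤ F * γ - c * Real.log (1 + γ) := by
  have hM1 : 0 < M + 1 := by linarith
  split_ifs at hγs with h1 h2
  · subst hγs
    refine ⟨⟨hM.le, le_rfl⟩, fun γ hγ => stmt11_aux F c _ γ hc hM.le hγ.1 ?_⟩
    rw [add_comm] at h1
    exact mul_nonneg_of_nonpos_of_nonpos (by linarith) (by linarith [hγ.2])
  · push Not at h1
    have hF : 0 < F := (div_pos hc hM1).trans h1
    have h0 : 0 ≤ γs := by
      have : 1 ≤ c / F := (one_le_div hF).2 h2
      linarith
    have hle : γs ≤ M := by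
      have : c / F ≤ M + 1 := by
        rw [div_lt_iff₀ hM1] at h1
        rw [div_le_iff₀ hF]
        linarith
      linarith
    refine ⟨⟨h0, hle⟩, fun γ hγ => stmt11_aux F c _ γ hc h0 hγ.1 ?_⟩
    have : c / (1 + γs) = F := by
      rw [hγs, add_sub_cancel]
      field_simp
    rw [this]
    simp
  · subst hγs
    push Not at h2
    refine ⟨⟨le_rfl, hM.le⟩, fun γ hγ => stmt11_aux F c _ γ hc le_rfl hγ.1 ?_⟩
    exact mul_nonneg (by simpa using h2.le) (by simpa using hγ.1)
end
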